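/- Let (R, 𝔪) be a Cohen-Macaulay Noetherian local ring and M a maximal Cohen-Macaulay R-module. Then r_R(M) ≤ r(R ⋉ M) ≤ r(R) + r_R(M), where r denotes Cohen-Macaulay type. -/

import Mathlib

universe u

open TrivSqZeroExt IsLocalRing


open TrivSqZeroExt

/-- The ideal `I × N` of the idealization `R ⋉ M` (a homogeneous ideal), for an ideal `I`
of `R` and a submodule `N` of `M` with `I M ⊆ N`. -/
def idealProd {R M : Type*} [CommRing R] [AddCommGroup M] [Module R M] [Module Rᵐᵒᵖ M]
    [IsCentralScalar R M] (I : Ideal R) (N : Submodule R M)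
    (h : ∀ a ∈ I, ∀ m : M, a • m ∈ N) : Ideal (TrivSqZeroExt R M) where
  carrier := {x | x.fst ∈ I ∧ x.snd ∈ N}
  zero_mem' := ⟨I.zero_mem, N.zero_mem⟩
  add_mem' := fun ha hb => ⟨I.add_mem ha.1 hb.1, N.add_mem ha.2 hb.2⟩
  smul_mem' := fun c x hx => by
    refine ⟨I.mul_mem_left c.fst hx.1, ?_⟩
    show (c * x).snd ∈ N
    rw [snd_mul, op_smul_eq_smul]
    exact N.add_mem (N.smul_mem _ hx.2) (h x.fst hx.1 c.snd)


instance tszeIsLocalRing {R M : Type*} [CommRing R] [IsLocalRing R] [AddCommGroup M]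
    [Module R M] [Module Rᵐᵒᵖ M] [IsCentralScalar R M] :
    IsLocalRing (TrivSqZeroExt R M) := by
  haveI : Nontrivial (TrivSqZeroExt R M) :=
    ⟨⟨0, 1, fun h => zero_ne_one (congrArg TrivSqZeroExt.fst h)⟩⟩
  refine IsLocalRing.of_isUnit_or_isUnit_of_isUnit_add (fun {a b} h => ?_)
  have hf : IsUnit (a.fst + b.fst) := by
    have := h.map (TrivSqZeroExt.fstHom R R M)
    simpa using this
  rcases IsLocalRing.isUnit_or_isUnit_of_isUnit_add hf with h' | h'
  · left
    rcases h'.nonempty_invertible with ⟨inv⟩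
    letI := inv
    letI := TrivSqZeroExt.invertibleOfInvertibleFst a
    exact isUnit_of_invertible a
  · right
    rcases h'.nonempty_invertible with ⟨inv⟩
    letI := inv
    letI := TrivSqZeroExt.invertibleOfInvertibleFst b
    exact isUnit_of_invertible b

/-- The length of an `R`-module `M`: the Krull dimension of its lattice of submodules,
i.e. the supremum of the lengths of chains of submodules of `M`. -/
noncomputable def moduleLength (R M : Type*) [CommRing R] [AddCommGroup M] [Module R M] :
    WithBot ℕ∞ :=
  Order.krullDim (Submodule R M)

/-- The Ext group `Ext_R^n(R/𝔪, M)` over a local ring `(R, 𝔪)`. -/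
noncomputable def extResidue (R M : Type u) [CommRing R] [IsLocalRing R] [AddCommGroup M]
    [Module R M] (n : ℕ) : ModuleCat.{u} R :=
  ((Ext R (ModuleCat.{u} R) n).obj
      (Opposite.op (ModuleCat.of R (IsLocalRing.ResidueField R)))).obj (ModuleCat.of R M)

/-- `dim_{R/𝔪} Ext_R^t(R/𝔪, M)`, computed as a length over `R`; for a Cohen-Macaulay module
`M` of depth `t` this is the (Cohen-Macaulay) type `r_R(M)`. -/
noncomputable def cmTypeAt (R M : Type u) [CommRing R] [IsLocalRing R] [AddCommGroup M]
    [Module R M] (t : ℕ) : WithBot ℕ∞ :=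
  moduleLength R (extResidue R M t)

/-- The depth of a module `M` over a local ring `(R, 𝔪)`:
`inf {n : Ext_R^n(R/𝔪, M) ≠ 0}`. -/
noncomputable def moduleDepth (R M : Type u) [CommRing R] [IsLocalRing R] [AddCommGroup M]
    [Module R M] : ℕ∞ :=
  sInf {n : ℕ∞ | ∃ i : ℕ, n = i ∧ Nontrivial (extResidue R M i)}

/-- `Q` is a parameter ideal of the `d`-dimensional local ring `R` (resp. of a
`d`-dimensional module) if it is generated by `d` elements and is `𝔪`-primary. -/
def IsParameterIdeal {R : Type u} [CommRing R] [IsLocalRing R] (Q : Ideal R) (d : ℕ) : Prop :=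
  ∃ s : Finset R, Q = Ideal.span (s : Set R) ∧ s.card = d ∧
    Q.radical = IsLocalRing.maximalIdeal R

section

open CategoryTheory

namespace CategoryTheory.ProjectiveResolution

variable {C : Type*} [Category* C] [Abelian C] [HasExt.{u} C] {X Y : C}

lemma extMk_eq_zero_iff_of_zero (P : ProjectiveResolution X) (f : P.complex.X 0 ⟶ Y) (m : ℕ)
    (hm : 0 + 1 = m) (hf : P.complex.d m 0 ≫ f = 0) :
    P.extMk f m hm hf = 0 ↔ f = 0 := by
  refine ⟨fun h => ?_, fun h => by subst h; simp⟩
  rw [← P.extEquivCohomologyClass.apply_eq_iff_eq, extEquivCohomologyClass_extMk,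
    extEquivCohomologyClass_zero, CochainComplex.HomComplex.CohomologyClass.mk_eq_zero_iff,
    CochainComplex.HomComplex.Cocycle.toSingleMk_mem_coboundaries_iff _ _ _ _ _ 1 (by simp)] at h
  obtain ⟨g, hg⟩ := h
  have hX : Limits.IsZero (P.cochainComplex.X 1) := by
    apply P.cochainComplex.isZero_of_isStrictlyLE 0 1
  rw [hX.eq_of_src g 0, Limits.comp_zero] at hg
  rw [← cancel_epi (P.cochainComplexXIso (-0) 0 rfl).hom, Limits.comp_zero]
  exact hg.symm

lemma smul_extMk {A : Type*} [Ring A] [Linear A C] (P : ProjectiveResolution X) {n : ℕ}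
    (a : A) (f : P.complex.X n ⟶ Y) (m : ℕ) (hm : n + 1 = m)
    (hf : P.complex.d m n ≫ f = 0) :
    a • P.extMk f m hm hf = P.extMk (a • f) m hm (by simp [hf]) := by
  rw [Abelian.Ext.smul_eq_comp_mk₀, extMk_comp_mk₀]
  simp

/-- The class in `Ext X Y n` of a cocycle of the complex of morphisms from a projective
resolution of `X` to `Y`, as a linear map. -/
noncomputable def cocycleToExt (A : Type*) [Ring A] [Linear A C] (P : ProjectiveResolution X)
    (Y : C) (n : ℕ) :
    LinearMap.ker ((P.complex.linearYonedaObj A Y).sc n).g.hom →ₗ[A] Abelian.Ext X Y n where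
  toFun f := P.extMk (show P.complex.X n ⟶ Y from f.1) ((ComplexShape.up ℕ).next n)
    (CochainComplex.next ℕ n).symm f.2
  map_add' f g := (P.add_extMk f.1 g.1 _ _ f.2 g.2).symm
  map_smul' a f := (P.smul_extMk a f.1 _ _ f.2).symm

lemma cocycleToExt_surjective (A : Type*) [Ring A] [Linear A C] (P : ProjectiveResolution X)
    (Y : C) (n : ℕ) : Function.Surjective (P.cocycleToExt A Y n) := fun x => by
  obtain ⟨f, hf, rfl⟩ := P.extMk_surjective x ((ComplexShape.up ℕ).next n)
    (CochainComplex.next ℕ n).symm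
  exact ⟨⟨f, hf⟩, rfl⟩

lemma ker_cocycleToExt (A : Type*) [Ring A] [Linear A C] (P : ProjectiveResolution X)
    (Y : C) (n : ℕ) : LinearMap.ker (P.cocycleToExt A Y n) =
      LinearMap.range ((P.complex.linearYonedaObj A Y).sc n).moduleCatToCycles := by
  ext f
  obtain ⟨f, hf⟩ := f
  rw [LinearMap.mem_ker, LinearMap.mem_range]
  rcases n with _ | n
  · refine (P.extMk_eq_zero_iff_of_zero f _ (CochainComplex.next ℕ 0).symm hf).trans ⟨?_, ?_⟩
    · rintro rfl
      exact ⟨0, map_zero _⟩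
    · rintro ⟨g, hg⟩
      have hd : ((P.complex.linearYonedaObj A Y).sc 0).f = 0 :=
        (P.complex.linearYonedaObj A Y).shape _ _ (by
          rw [CochainComplex.prev_nat_zero]; simp)
      have h := congrArg Subtype.val hg
      change ((P.complex.linearYonedaObj A Y).sc 0).f.hom g = f at h
      rw [← h, hd]
      rfl
  · refine (P.extMk_eq_zero_iff f _ (CochainComplex.next ℕ (n + 1)).symm hf
      ((ComplexShape.up ℕ).prev (n + 1)) (by simp)).trans ⟨?_, ?_⟩
    · rintro ⟨g, hg⟩
      exact ⟨g, Subtype.ext hg⟩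
    · rintro ⟨g, hg⟩
      exact ⟨g, congrArg Subtype.val hg⟩

/-- The left derived `Ext` functors and the morphisms in the derived category compute the same
modules. -/
noncomputable def extLinearEquiv (A : Type*) [Ring A] [Linear A C] [EnoughProjectives C]
    (P : ProjectiveResolution X) (Y : C) (n : ℕ) :
    ((_root_.Ext A C n).obj (Opposite.op X)).obj Y ≃ₗ[A] Abelian.Ext X Y n :=
  (P.isoExt n Y ≪≫ ((P.complex.linearYonedaObj A Y).sc n).moduleCatHomologyIso).toLinearEquiv ≪≫ₗ
    Submodule.quotEquivOfEq _ _ (P.ker_cocycleToExt A Y n).symm ≪≫ₗ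
    (P.cocycleToExt A Y n).quotKerEquivOfSurjective (P.cocycleToExt_surjective A Y n)

end CategoryTheory.ProjectiveResolution

lemma Module.length_le_add_of_exact {A N₁ N₂ N₃ : Type*} [Ring A] [AddCommGroup N₁]
    [AddCommGroup N₂] [AddCommGroup N₃] [Module A N₁] [Module A N₂] [Module A N₃]
    (f : N₁ →ₗ[A] N₂) (g : N₂ →ₗ[A] N₃) (h : Function.Exact f g) :
    Module.length A N₂ ≤ Module.length A N₁ + Module.length A N₃ := by
  rw [Module.length_eq_add_of_exact (LinearMap.range f).subtype g.rangeRestrict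
    (Submodule.subtype_injective _) g.surjective_rangeRestrict (fun x => by
      simpa [Subtype.ext_iff] using h x)]
  exact add_le_add (Module.length_le_of_surjective f.rangeRestrict f.surjective_rangeRestrict)
    (Module.length_le_of_injective (LinearMap.range g).subtype (Submodule.subtype_injective _))

variable {A : Type u} [CommRing A]

open Abelian

/-- Dimension shifting: if `a` annihilates `X` and is regular on `N`, then
`Ext X (N / a N) n ≃ Ext X N (n + 1)` as soon as `Ext X N n = 0`. -/
lemma nonempty_linearEquiv_ext_succ {N N' : Type u} [AddCommGroup N] [AddCommGroup N'] [Module A N]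
    [Module A N'] {a : A} (ha : IsSMulRegular N a) {g : N →ₗ[A] N'} (hg : Function.Surjective g)
    (hag : Function.Exact (LinearMap.lsmul A N a) g) (X : ModuleCat.{u} A)
    (haX : a ∈ Module.annihilator A X) (n : ℕ) (hn : Subsingleton (Ext X (ModuleCat.of A N) n)) :
    Nonempty (Ext X (ModuleCat.of A N') n ≃ₗ[A] Ext X (ModuleCat.of A N) (n + 1)) := by
  let S := ModuleCat.shortComplexOfCompEqZero (LinearMap.lsmul A N a) g hag.linearMap_comp_eq_zero
  have hS : S.ShortExact :=
    { exact := ModuleCat.shortComplex_exact _ hag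
      mono_f := (ModuleCat.mono_iff_injective _).2 ha
      epi_g := (ModuleCat.epi_iff_surjective _).2 hg }
  refine ⟨LinearEquiv.ofBijective (hS.extClass.postcompOfLinear A X rfl) ⟨?_, fun x => ?_⟩⟩
  · rw [injective_iff_map_eq_zero]
    intro x hx
    obtain ⟨y, rfl⟩ := Ext.covariant_sequence_exact₃ X hS x rfl hx
    rw [Subsingleton.elim (α := Ext X (ModuleCat.of A N) n) y 0, Ext.zero_comp]
  · refine Ext.covariant_sequence_exact₁ X hS x ?_ rfl
    have hf : S.f = a • 𝟙 S.X₁ := rfl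
    have hX : a • 𝟙 X = 0 := by
      ext x
      exact Module.mem_annihilator.1 haX x
    calc x.comp (Ext.mk₀ S.f) (add_zero _) = a • x := by rw [hf, Ext.smul_eq_comp_mk₀]
      _ = (Ext.mk₀ (a • 𝟙 X)).comp x (zero_add _) := by simp [Ext.mk₀_smul]
      _ = 0 := by simp [hX]

section Residue

/-- The residue field of a local ring, as an object of the category of modules. -/
noncomputable abbrev residueModule (R : Type u) [CommRing R] [IsLocalRing R] : ModuleCat.{u} R :=
  ModuleCat.of R (ResidueField R)

lemma annihilator_residueField (R : Type*) [CommRing R] [IsLocalRing R] :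
    Module.annihilator R (ResidueField R) = maximalIdeal R :=
  Ideal.annihilator_quotient

variable (S R : Type u) [CommRing S] [IsLocalRing S] [CommRing R] [IsLocalRing R] [Algebra S R]

variable (N : Type u) [AddCommGroup N] [Module R N] [Module S N] [IsScalarTower S R N]

lemma length_ext_zero_residueModule_eq (h : Function.Surjective (algebraMap S R)) :
    Module.length S (Abelian.Ext (residueModule S) (ModuleCat.of S N) 0) =
      Module.length R (Abelian.Ext (residueModule R) (ModuleCat.of R N) 0) := by
  have : IsLocalHom (algebraMap S R) := .of_surjective _ h
  let e : ResidueField S ≃ₗ[S] ResidueField R := LinearEquiv.ofBijective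
    { toFun := ResidueField.map (algebraMap S R)
      map_add' := map_add _
      map_smul' := fun s x => by
        obtain ⟨x, rfl⟩ := residue_surjective x
        rw [RingHom.id_apply, Algebra.smul_def, Algebra.smul_def, map_mul,
          IsScalarTower.algebraMap_apply S R (ResidueField R)]
        rfl }
    ⟨RingHom.injective _, fun y => by
      obtain ⟨y, rfl⟩ := residue_surjective y
      obtain ⟨x, rfl⟩ := h y
      exact ⟨residue S x, rfl⟩⟩
  rw [(Abelian.Ext.linearEquiv₀ (R := S)).length_eq, (Abelian.Ext.linearEquiv₀ (R := R)).length_eq,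
    (ModuleCat.homLinearEquiv (S := S)).length_eq, (ModuleCat.homLinearEquiv (S := R)).length_eq,
    ← Module.length_eq_of_surjective h]
  exact ((e.congrLeft N S).trans (LinearMap.extendScalarsOfSurjectiveEquiv h)).length_eq

variable [IsNoetherianRing R]

open scoped Pointwise in
/-- For a surjection `S → R` of local rings and a finite `R`-module `N`, the modules
`Ext^i(k, N)` over `R` and over `S` have the same length in the first degree in which
they may be nonzero. -/
theorem ext_residueModule_of_surjective (h : Function.Surjective (algebraMap S R)) (n : ℕ) [Module.Finite R N]
    (hN : ∀ i < n, Subsingleton (Abelian.Ext (residueModule R) (ModuleCat.of R N) i)) :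
    (∀ i < n, Subsingleton (Abelian.Ext (residueModule S) (ModuleCat.of S N) i)) ∧
      Module.length S (Abelian.Ext (residueModule S) (ModuleCat.of S N) n) =
        Module.length R (Abelian.Ext (residueModule R) (ModuleCat.of R N) n) := by
  have h0 := length_ext_zero_residueModule_eq S R N h
  induction n generalizing N with
  | zero => exact ⟨by simp, h0⟩
  | succ n ih =>
    have hN0 := hN 0 n.succ_pos
    have : Subsingleton (ResidueField R →ₗ[R] N) :=
      ((ModuleCat.homLinearEquiv (S := R) (M := residueModule R) (N := ModuleCat.of R N)).symm.trans
        Abelian.Ext.linearEquiv₀.symm).subsingleton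
    obtain ⟨x, hxk, hx⟩ := IsSMulRegular.subsingleton_linearMap_iff.1 this
    obtain ⟨s, rfl⟩ := h x
    have : IsLocalHom (algebraMap S R) := .of_surjective _ h
    have hsk : s ∈ Module.annihilator S (ResidueField S) := by
      rw [annihilator_residueField] at hxk ⊢
      simpa [mem_maximalIdeal, mem_nonunits_iff, isUnit_map_iff] using hxk
    let N' := QuotSMulTop (algebraMap S R s) N
    let g := (algebraMap S R s • (⊤ : Submodule R N)).mkQ
    have hg : Function.Surjective g := Submodule.mkQ_surjective _
    have hex := LinearMap.exact_lsmul_mkQ_smul_top N (algebraMap S R s)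
    have hR := nonempty_linearEquiv_ext_succ hx hg hex (residueModule R) hxk
    have hS := nonempty_linearEquiv_ext_succ (A := S) (a := s) (N := N) (N' := N')
      (fun y z hyz => hx (by simpa using hyz)) (g := g.restrictScalars S) hg
      (fun y => by simpa [N', g] using hex y) (residueModule S) hsk
    have hN' : ∀ i < n, Subsingleton (Abelian.Ext (residueModule R) (ModuleCat.of R N') i) :=
      fun i hi => by
        have := hN (i + 1) (by lia)
        obtain ⟨e⟩ := hR i (hN i (by lia))
        exact e.subsingleton
    obtain ⟨hv, hl⟩ := ih N' hN' (length_ext_zero_residueModule_eq S R N' h)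
    have hvS : ∀ i < n + 1, Subsingleton (Abelian.Ext (residueModule S) (ModuleCat.of S N) i) := by
      intro i
      induction i with
      | zero =>
        intro _
        rwa [← Module.length_eq_zero_iff (R := S), h0, Module.length_eq_zero_iff]
      | succ i ihi =>
        intro hi
        have := hv i (by lia)
        obtain ⟨e⟩ := hS i (ihi (by lia))
        exact e.symm.subsingleton
    refine ⟨hvS, ?_⟩
    obtain ⟨e⟩ := hS n (hvS n (by lia))
    obtain ⟨e'⟩ := hR n (hN n (by lia))
    rw [← e.length_eq, hl, e'.length_eq]

end Residue


lemma moduleLength_eq_length (R M : Type*) [CommRing R] [AddCommGroup M] [Module R M] :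
    moduleLength R M = Module.length R M :=
  (Module.coe_length R M).symm

/-- `extResidue` agrees with the `Ext` modules defined through the derived category. -/
noncomputable def extResidueLinearEquiv (R M : Type u) [CommRing R] [IsLocalRing R]
    [AddCommGroup M] [Module R M] (n : ℕ) :
    extResidue R M n ≃ₗ[R] Abelian.Ext (residueModule R) (ModuleCat.of R M) n :=
  (projectiveResolution (residueModule R)).extLinearEquiv R (ModuleCat.of R M) n

lemma cmTypeAt_eq_length_ext (R M : Type u) [CommRing R] [IsLocalRing R]
    [AddCommGroup M] [Module R M] (n : ℕ) :
    cmTypeAt R M n =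
      Module.length R (Abelian.Ext (residueModule R) (ModuleCat.of R M) n) := by
  rw [cmTypeAt, moduleLength_eq_length, (extResidueLinearEquiv R M n).length_eq]

lemma subsingleton_ext_of_lt_moduleDepth {R M : Type u} [CommRing R] [IsLocalRing R]
    [AddCommGroup M] [Module R M] {i : ℕ} (hi : i < moduleDepth R M) :
    Subsingleton (Abelian.Ext (residueModule R) (ModuleCat.of R M) i) := by
  by_contra h
  rw [← (extResidueLinearEquiv R M i).toEquiv.subsingleton_congr,
    not_subsingleton_iff_nontrivial] at h
  exact hi.not_ge (sInf_le ⟨i, rfl, h⟩)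

end

open CategoryTheory in

/-- If `R` is Cohen-Macaulay local of dimension `d` and `M` is a maximal Cohen-Macaulay
`R`-module, then `r_R(M) ≤ r(R ⋉ M) ≤ r(R) + r_R(M)`, where `r` is the Cohen-Macaulay type. -/
theorem cmType_idealization_le (R M : Type u) [CommRing R] [IsNoetherianRing R] [IsLocalRing R]
    [AddCommGroup M] [Module R M] [Module Rᵐᵒᵖ M] [IsCentralScalar R M] [Module.Finite R M]
    (d : ℕ) (hdim : ringKrullDim R = d) (hRCM : moduleDepth R R = d)
    (hMCM : moduleDepth R M = d) :
    cmTypeAt R M d ≤ cmTypeAt (TrivSqZeroExt R M) (TrivSqZeroExt R M) d ∧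
      cmTypeAt (TrivSqZeroExt R M) (TrivSqZeroExt R M) d ≤ cmTypeAt R R d + cmTypeAt R M d := by
  let := (fstHom R R M).toRingHom.toAlgebra
  let := Module.compHom M (fstHom R R M).toRingHom
  have : IsScalarTower (TrivSqZeroExt R M) R M := ⟨fun s r m => mul_smul s.fst r m⟩
  have hsurj : Function.Surjective (algebraMap (TrivSqZeroExt R M) R) := fst_surjective
  obtain ⟨hvR, hlR⟩ := ext_residueModule_of_surjective (TrivSqZeroExt R M) R R hsurj d fun i hi =>
    subsingleton_ext_of_lt_moduleDepth (by rw [hRCM]; exact_mod_cast hi)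
  obtain ⟨-, hlM⟩ := ext_residueModule_of_surjective (TrivSqZeroExt R M) R M hsurj d fun i hi =>
    subsingleton_ext_of_lt_moduleDepth (by rw [hMCM]; exact_mod_cast hi)
  let f : M →ₗ[TrivSqZeroExt R M] TrivSqZeroExt R M :=
    { toFun := inr
      map_add' := inr_add R
      map_smul' := fun s m => by
        ext
        · simp
        · simp; rfl }
  let g : TrivSqZeroExt R M →ₗ[TrivSqZeroExt R M] R := Algebra.linearMap _ _
  have hfg : Function.Exact f g := fun x => by
    refine ⟨fun hx => ⟨x.snd, TrivSqZeroExt.ext hx.symm rfl⟩, ?_⟩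
    rintro ⟨m, rfl⟩
    rfl
  let T := ModuleCat.shortComplexOfCompEqZero f g hfg.linearMap_comp_eq_zero
  have hT : T.ShortExact :=
    { exact := ModuleCat.shortComplex_exact _ hfg
      mono_f := (ModuleCat.mono_iff_injective _).2 inr_injective
      epi_g := (ModuleCat.epi_iff_surjective _).2 hsurj }
  let k := residueModule (TrivSqZeroExt R M)
  let F := (Abelian.Ext.mk₀ T.f).postcompOfLinear (TrivSqZeroExt R M) k (add_zero d)
  let G := (Abelian.Ext.mk₀ T.g).postcompOfLinear (TrivSqZeroExt R M) k (add_zero d)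
  have hF : Function.Injective F := by
    rw [injective_iff_map_eq_zero]
    intro x hx
    rcases d with _ | d
    · have := hT.mono_f
      exact Abelian.Ext.postcomp_mk₀_injective_of_mono k T.f (by simpa [F] using hx)
    · obtain ⟨y, rfl⟩ := Abelian.Ext.covariant_sequence_exact₁ k hT x hx rfl
      have := hvR d d.lt_succ_self
      rw [Subsingleton.elim (α := Abelian.Ext k (ModuleCat.of _ R) d) y 0, Abelian.Ext.zero_comp]
  have hFG : Function.Exact F G := fun x => by
    refine ⟨fun hx => Abelian.Ext.covariant_sequence_exact₂ k hT x hx, ?_⟩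
    rintro ⟨y, rfl⟩
    simp [F, G, T.zero]
  simp only [cmTypeAt_eq_length_ext, ← hlR, ← hlM]
  norm_cast
  exact ⟨Module.length_le_of_injective F hF,
    (Module.length_le_add_of_exact F G hFG).trans_eq (add_comm _ _)⟩
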